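/- arXiv:2111.08989 — 3 statements merged into one kernel-verified Lean document; each statement's English description precedes it below -/
import Mathlib

section
/- Let U : ℝ² → ℂ be continuously differentiable and define u(x) = U(T·x). Then for every x ∈ ℝ², the second component of M·∇u(x) (the conormal derivative of u in the direction e₂ = (0,1)) satisfies (M·∇u(x))₂ = α·(det M)^{1/2}·(∂U/∂X₂)(T·x). -/
open Matrix

/-- If `N` is a positive definite square root of `M⁻¹`, then `√(det M) = (det N)⁻¹`. -/
theorem sqrt_det_eq_inv_det {n : Type*} [Fintype n] [DecidableEq n] {M N : Matrix n n ℝ}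
    (hN : N.PosDef) (hNsq : N * N = M⁻¹) : Real.sqrt M.det = N.det⁻¹ := by
  have hdet : M.det = (N.det⁻¹) ^ 2 := by
    have h := congrArg Matrix.det hNsq
    rw [Matrix.det_mul, Matrix.det_nonsing_inv, Ring.inverse_eq_inv'] at h
    rw [inv_pow, sq, h, inv_inv]
  rw [hdet, Real.sqrt_sq (inv_nonneg.mpr hN.det_pos.le)]

/-- Chain rule for precomposition with the linear map given by a matrix. -/
theorem fderiv_comp_mulVec {m n : Type*} [Fintype m] [Fintype n] {E : Type*}
    [NormedAddCommGroup E] [NormedSpace ℝ E] (T : Matrix m n ℝ) {U : (m → ℝ) → E}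
    {x : n → ℝ} (hU : DifferentiableAt ℝ U (T.mulVec x)) (v : n → ℝ) :
    fderiv ℝ (fun y => U (T.mulVec y)) x v = fderiv ℝ U (T.mulVec x) (T.mulVec v) := by
  have hT : HasFDerivAt (fun y => T.mulVec y)
      (LinearMap.toContinuousLinearMap (Matrix.mulVecLin T)) x :=
    (LinearMap.toContinuousLinearMap (Matrix.mulVecLin T)).hasFDerivAt
  have h := (HasFDerivAt.comp x hU.hasFDerivAt hT).fderiv
  exact congrArg (fun L => L v) h

/-- With `N = M^{-1/2}`, `α = √(a11² + a12²)`,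
`Q = (1/α)·[[a11, a12], [−a12, a11]]`, `T = Q·N`, let `U : ℝ² → ℂ` be `C¹` and
`u(x) = U(T·x)`.  Then for every `x`, the second component of `M·∇u(x)` (the conormal
derivative of `u` in the direction `e₂`) satisfies
`(M·∇u(x))₂ = α·(det M)^{1/2}·(∂U/∂X₂)(T·x)`. -/
theorem stmt6 (M N : Matrix (Fin 2) (Fin 2) ℝ)
    (hM : M.PosDef) (hN : N.PosDef) (hNsq : N * N = M⁻¹)
    (a11 a12 α : ℝ) (ha11 : a11 = N 0 0) (ha12 : a12 = N 0 1)
    (hα : α = Real.sqrt (a11 ^ 2 + a12 ^ 2))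
    (Q : Matrix (Fin 2) (Fin 2) ℝ)
    (hQ : Q = α⁻¹ • !![a11, a12; -a12, a11])
    (T : Matrix (Fin 2) (Fin 2) ℝ) (hT : T = Q * N)
    (U : (Fin 2 → ℝ) → ℂ) (hU : ContDiff ℝ 1 U)
    (u : (Fin 2 → ℝ) → ℂ) (hu : u = fun x => U (T.mulVec x)) :
    ∀ x : Fin 2 → ℝ,
      (∑ j : Fin 2, (M 1 j : ℂ) * fderiv ℝ u x (Pi.single j 1)) =
        ((α * Real.sqrt M.det : ℝ) : ℂ) * fderiv ℝ U (T.mulVec x) (Pi.single 1 1) := by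
  intro x
  have hdet := hN.det_pos
  have hsqrt := sqrt_det_eq_inv_det hN hNsq
  have hMNN : M * N * N = 1 := by
    rw [mul_assoc, hNsq, Matrix.mul_nonsing_inv _ hM.det_pos.ne'.isUnit]
  have hsymm : N 1 0 = N 0 1 := by simpa using hN.isHermitian.apply 0 1
  have hpos : 0 < N 0 0 := hN.diag_pos
  have hα2 : α ^ 2 = a11 ^ 2 + a12 ^ 2 := by rw [hα, Real.sq_sqrt (by positivity)]
  have hα0 : α ≠ 0 := by
    rw [hα, ha11]
    positivity
  have h0 := congrFun (congrFun hMNN 1) 0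
  have h1 := congrFun (congrFun hMNN 1) 1
  have hcol : T.mulVec (M 1) = (α * Real.sqrt M.det) • Pi.single 1 1 := by
    rw [hsqrt]
    rw [Matrix.det_fin_two] at hdet ⊢
    simp only [Matrix.mul_apply, Fin.sum_univ_two, hsymm, Matrix.one_apply_eq,
      Matrix.one_apply_ne one_ne_zero] at h0 h1
    rw [hsymm] at hdet ⊢
    rw [ha11, ha12] at hα2
    ext i
    fin_cases i
    · simp [hT, hQ, Matrix.mulVec, Matrix.vecMul, dotProduct, Fin.sum_univ_two, hsymm,
        ha11, ha12]
      linear_combination α⁻¹ * h0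
    · simp [hT, hQ, Matrix.mulVec, Matrix.vecMul, dotProduct, Fin.sum_univ_two, hsymm,
        ha11, ha12]
      have hd : N 0 0 * N 1 1 - N 0 1 ^ 2 ≠ 0 := by rw [sq]; exact hdet.ne'
      field_simp
      rw [hα2]
      linear_combination (N 0 0 ^ 2 + N 0 1 ^ 2) * h1 - (N 0 0 * N 0 1 + N 0 1 * N 1 1) * h0
  have hU' : DifferentiableAt ℝ U (T.mulVec x) := (hU.differentiable one_ne_zero) _
  have hM1 : M 1 = ∑ j : Fin 2, M 1 j • (Pi.single j 1 : Fin 2 → ℝ) := pi_eq_sum_univ' (M 1)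
  calc (∑ j : Fin 2, (M 1 j : ℂ) * fderiv ℝ u x (Pi.single j 1))
      = fderiv ℝ u x (M 1) := by
        conv_rhs => rw [hM1]
        simp only [map_sum, map_smul, Complex.real_smul]
    _ = ((α * Real.sqrt M.det : ℝ) : ℂ) * fderiv ℝ U (T.mulVec x) (Pi.single 1 1) := by
        rw [hu, fderiv_comp_mulVec T hU', hcol, map_smul, Complex.real_smul]
end

section
/- For every x* = (x₁*, x₂*) with x₂* > 0 and every X = (X₁, X₂) with X₂ < 0, the following reciprocity identity between two Fourier integrals holds: (i·α/(2π)) ∫_ℝ e^{i μ(α ξ) x₂* − i μ(ξ) X₂ + i α ξ x₁* − i ξ X₁} / (μ(α ξ) + c·α·μ(ξ)) dξ = (i/(2π)) ∫_ℝ e^{−i μ(α⁻¹ η) X₂ + i α⁻¹ η X₁ + i μ(η) x₂* − i η x₁*} / (c·α·μ(α⁻¹ η) + μ(η)) dη. In terms of the background Green's function of the two-layer medium, this says G(x; x*) = G(x*; x) when the source x* lies in the upper half-plane and the observation point (with transformed coordinates X) lies in the lower half-plane. -/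
open MeasureTheory

/-- The function `μ(ξ) = √(k₀² − ξ²)` for `|ξ| ≤ k₀` and `μ(ξ) = i·√(ξ² − k₀²)` for
`|ξ| > k₀` (the principal square root of `k₀² − ξ²`). -/
noncomputable def mu (k₀ ξ : ℝ) : ℂ :=
  if |ξ| ≤ k₀ then ((Real.sqrt (k₀ ^ 2 - ξ ^ 2) : ℝ) : ℂ)
  else Complex.I * ((Real.sqrt (ξ ^ 2 - k₀ ^ 2) : ℝ) : ℂ)

/-- `mu k₀` is even. -/
lemma mu_neg (k₀ ξ : ℝ) : mu k₀ (-ξ) = mu k₀ ξ := by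
  simp [mu]

/-- Reflecting and rescaling an integral over the real line. -/
lemma integral_eq_mul_integral_comp_neg_mul {α : ℝ} (hα : 0 < α) (f : ℝ → ℂ) :
    ∫ η, f η = (α : ℂ) * ∫ ξ, f (-α * ξ) := by
  rw [Measure.integral_comp_mul_left f (-α), inv_neg, abs_neg, abs_of_pos (inv_pos.2 hα),
    Complex.real_smul, Complex.ofReal_inv, mul_inv_cancel_left₀ (by exact_mod_cast hα.ne')]

/-- reciprocity identity `G(x; x*) = G(x*; x)` for the two-layer
background Green's function, with source `x* = (xs1, xs2)`, `xs2 > 0`, in the upper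
half-plane and observation point with transformed coordinates `X = (X1, X2)`, `X2 < 0`,
in the lower half-plane, expressed as an equality of two Fourier integrals. -/
theorem stmt10 (k₀ α c xs1 xs2 X1 X2 : ℝ)
    (hk₀ : 0 < k₀) (hα : 0 < α) (hc : 0 < c) (hxs2 : 0 < xs2) (hX2 : X2 < 0) :
    (Complex.I * (α : ℂ) / (2 * (Real.pi : ℂ))) *
        ∫ ξ : ℝ, Complex.exp (Complex.I * mu k₀ (α * ξ) * (xs2 : ℂ)
            - Complex.I * mu k₀ ξ * (X2 : ℂ)
            + Complex.I * ((α * ξ * xs1 : ℝ) : ℂ) - Complex.I * ((ξ * X1 : ℝ) : ℂ)) /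
          (mu k₀ (α * ξ) + (c : ℂ) * (α : ℂ) * mu k₀ ξ) =
      (Complex.I / (2 * (Real.pi : ℂ))) *
        ∫ η : ℝ, Complex.exp (-(Complex.I * mu k₀ (α⁻¹ * η) * (X2 : ℂ))
            + Complex.I * ((α⁻¹ * η * X1 : ℝ) : ℂ)
            + Complex.I * mu k₀ η * (xs2 : ℂ) - Complex.I * ((η * xs1 : ℝ) : ℂ)) /
          ((c : ℂ) * (α : ℂ) * mu k₀ (α⁻¹ * η) + mu k₀ η) := by
  conv_rhs => rw [integral_eq_mul_integral_comp_neg_mul hα]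
  rw [← mul_assoc]
  congr 1
  · ring
  · congr 1 with ξ
    have hξ : α⁻¹ * (-α * ξ) = -ξ := by field_simp
    rw [hξ, neg_mul α, mu_neg, mu_neg]
    push_cast
    congr 1
    · congr 1
      ring
    · ring
end

section
/- Fix x₂* > 0 and X₂ < 0, and arbitrary real x₁*, X₁. For all α > 0 and c > 0, the function ξ ↦ e^{i μ(α ξ)·x₂* − i μ(ξ)·X₂ + i α ξ·x₁* − i ξ·X₁} / ( μ(α ξ) + c·α·μ(ξ) ) is Lebesgue integrable on ℝ. In particular, even in the case α = 1, where the denominator vanishes at ξ = ±k₀, the singularity is integrable and the defining integral of the lower-half-plane background Green's function exists. -/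
open MeasureTheory

lemma measurable_mu (k₀ : ℝ) : Measurable (mu k₀) := by
  unfold mu
  refine Measurable.ite (measurableSet_le (by fun_prop) (by fun_prop)) ?_ ?_ <;> fun_prop

lemma mu_re_nonneg (k₀ ξ : ℝ) : 0 ≤ (mu k₀ ξ).re := by
  unfold mu
  split_ifs <;> simp [Real.sqrt_nonneg]

lemma mu_im_nonneg (k₀ ξ : ℝ) : 0 ≤ (mu k₀ ξ).im := by
  unfold mu
  split_ifs <;> simp [Real.sqrt_nonneg]

lemma abs_sub_le_mu_im {k₀ : ℝ} (hk₀ : 0 < k₀) (ξ : ℝ) : |ξ| - k₀ ≤ (mu k₀ ξ).im := by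
  by_cases h : |ξ| ≤ k₀
  · exact (sub_nonpos.2 h).trans (mu_im_nonneg k₀ ξ)
  · simp only [mu, h, if_false, Complex.mul_im, Complex.I_re, Complex.I_im, Complex.ofReal_re,
      Complex.ofReal_im, zero_mul, one_mul, zero_add]
    apply Real.le_sqrt_of_sq_le
    rw [← sq_abs ξ]
    nlinarith

lemma norm_mu (k₀ ξ : ℝ) :
    ‖mu k₀ ξ‖ = Real.sqrt |(|ξ| - k₀)| * Real.sqrt (|ξ| + k₀) := by
  rw [← Real.sqrt_mul (abs_nonneg _)]
  unfold mu
  split_ifs with h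
  · rw [Complex.norm_real, Real.norm_of_nonneg (Real.sqrt_nonneg _), abs_of_nonpos (by linarith),
      ← sq_abs ξ]
    ring_nf
  · rw [norm_mul, Complex.norm_I, Complex.norm_real, Real.norm_of_nonneg (Real.sqrt_nonneg _),
      abs_of_nonneg (by linarith), ← sq_abs ξ]
    ring_nf

lemma norm_le_norm_add_of_re_im_nonneg {a b : ℂ} (har : 0 ≤ a.re) (hai : 0 ≤ a.im)
    (hbr : 0 ≤ b.re) (hbi : 0 ≤ b.im) : ‖b‖ ≤ ‖a + b‖ := by
  rw [Complex.norm_def, Complex.norm_def]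
  apply Real.sqrt_le_sqrt
  simp only [Complex.normSq_apply, Complex.add_re, Complex.add_im]
  nlinarith [mul_nonneg har hbr, mul_nonneg hai hbi]

lemma integrable_comp_abs_of_integrableOn_Ioi {f : ℝ → ℝ} (hf : IntegrableOn f (Set.Ioi 0)) :
    Integrable fun x : ℝ => f |x| := by
  have hpos : IntegrableOn (fun x : ℝ => f |x|) (Set.Ioi 0) :=
    hf.congr_fun (fun x hx => by simp only [abs_of_pos (Set.mem_Ioi.1 hx)]) measurableSet_Ioi
  have hneg : IntegrableOn (fun x : ℝ => f |x|) (Set.Iic 0) := by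
    have hm : MeasurableEmbedding fun x : ℝ => -x := (Homeomorph.neg ℝ).measurableEmbedding
    rw [← Measure.map_neg_eq_self (volume : Measure ℝ), hm.integrableOn_map_iff]
    simpa [Function.comp_def, integrableOn_Ici_iff_integrableOn_Ioi] using hpos
  rw [← integrableOn_univ, ← Set.Iic_union_Ioi (a := (0 : ℝ))]
  exact hneg.union hpos

lemma integrable_exp_mul_abs_div_sqrt_abs {b : ℝ} (hb : b < 0) :
    Integrable (fun s : ℝ => Real.exp (b * |s|) / Real.sqrt |s|) := by
  refine integrable_comp_abs_of_integrableOn_Ioi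
    (f := fun s : ℝ => Real.exp (b * s) / Real.sqrt s) ?_
  have h := integrableOn_rpow_mul_exp_neg_mul_rpow (s := -1 / 2) (p := 1) (b := -b)
    (by norm_num) one_pos (by linarith)
  refine h.congr_fun (fun s hs => ?_) measurableSet_Ioi
  have hs : 0 < s := hs
  simp only [Real.rpow_one, neg_neg]
  rw [Real.sqrt_eq_rpow, div_eq_mul_inv (Real.exp _), ← Real.rpow_neg hs.le, mul_comm]
  norm_num

/-- for `xs2 > 0`, `X2 < 0` and any `α, c > 0`, the integrand of the
lower-half-plane background Green's function,
`ξ ↦ e^{i μ(αξ) xs2 − i μ(ξ) X2 + i αξ xs1 − i ξ X1} / (μ(αξ) + cα μ(ξ))`,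
is Lebesgue integrable on `ℝ` (even for `α = 1`, where the denominator vanishes at
`ξ = ±k₀`, the singularity is integrable). -/
theorem stmt18 (k₀ xs1 xs2 X1 X2 : ℝ)
    (hk₀ : 0 < k₀) (hxs2 : 0 < xs2) (hX2 : X2 < 0) :
    ∀ α c : ℝ, 0 < α → 0 < c →
      Integrable (fun ξ : ℝ =>
        Complex.exp (Complex.I * mu k₀ (α * ξ) * ((xs2 : ℝ) : ℂ)
            - Complex.I * mu k₀ ξ * ((X2 : ℝ) : ℂ)
            + Complex.I * ((α * ξ * xs1 : ℝ) : ℂ)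
            - Complex.I * ((ξ * X1 : ℝ) : ℂ)) /
          (mu k₀ (α * ξ) + (c : ℂ) * (α : ℂ) * mu k₀ ξ)) := by
  intro α c hα hc
  have hcα : 0 < c * α := mul_pos hc hα
  have hH := integrable_exp_mul_abs_div_sqrt_abs hX2
  refine (((hH.comp_sub_right k₀).add (hH.comp_add_right k₀)).const_mul
    (Real.exp (-2 * X2 * k₀) / (c * α * Real.sqrt k₀))).mono' ?_ ?_
  · have h1 := measurable_mu k₀
    have h2 : Measurable fun ξ : ℝ => mu k₀ (α * ξ) := h1.comp (by fun_prop)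
    exact Measurable.aestronglyMeasurable (by fun_prop)
  · filter_upwards [Measure.ae_ne volume k₀, Measure.ae_ne volume (-k₀)] with ξ hξ₁ hξ₂
    have hs : |ξ| - k₀ ≠ 0 := by
      intro h
      rcases (abs_eq hk₀.le).1 (sub_eq_zero.1 h) with h | h
      exacts [hξ₁ h, hξ₂ h]
    have hsqrt : 0 < Real.sqrt |(|ξ| - k₀)| := Real.sqrt_pos.2 (abs_pos.2 hs)
    have hsqrt' : 0 < Real.sqrt k₀ := Real.sqrt_pos.2 hk₀
    have hden : c * α * Real.sqrt k₀ * Real.sqrt |(|ξ| - k₀)| ≤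
        ‖mu k₀ (α * ξ) + (c : ℂ) * (α : ℂ) * mu k₀ ξ‖ := by
      have hb : (c : ℂ) * (α : ℂ) * mu k₀ ξ = ((c * α : ℝ) : ℂ) * mu k₀ ξ := by push_cast; rfl
      rw [hb]
      refine le_trans ?_ (norm_le_norm_add_of_re_im_nonneg (mu_re_nonneg _ _) (mu_im_nonneg _ _)
        ?_ ?_)
      · rw [norm_mul, Complex.norm_real, Real.norm_of_nonneg hcα.le, norm_mu, mul_assoc,
          mul_comm (Real.sqrt k₀)]
        gcongr
        linarith [abs_nonneg ξ]
      · rw [Complex.re_ofReal_mul]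
        exact mul_nonneg hcα.le (mu_re_nonneg _ _)
      · rw [Complex.im_ofReal_mul]
        exact mul_nonneg hcα.le (mu_im_nonneg _ _)
    have hnum : ‖Complex.exp (Complex.I * mu k₀ (α * ξ) * ((xs2 : ℝ) : ℂ)
            - Complex.I * mu k₀ ξ * ((X2 : ℝ) : ℂ)
            + Complex.I * ((α * ξ * xs1 : ℝ) : ℂ)
            - Complex.I * ((ξ * X1 : ℝ) : ℂ))‖ ≤
        Real.exp (-2 * X2 * k₀) * Real.exp (X2 * |(|ξ| - k₀)|) := by
      rw [Complex.norm_exp, ← Real.exp_add]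
      apply Real.exp_le_exp.2
      simp only [Complex.add_re, Complex.sub_re, Complex.mul_re, Complex.mul_im, Complex.I_re,
        Complex.I_im, Complex.ofReal_re, Complex.ofReal_im]
      have h1 := mul_nonneg (mu_im_nonneg k₀ (α * ξ)) hxs2.le
      have h2 := mul_le_mul_of_nonpos_left (abs_sub_le_mu_im hk₀ ξ) hX2.le
      have h3 : |(|ξ| - k₀)| ≤ |ξ| - k₀ + 2 * k₀ :=
        abs_le.2 ⟨by linarith [abs_nonneg ξ], by linarith⟩
      have h4 := mul_le_mul_of_nonpos_left h3 hX2.le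
      linarith
    have hsum : Real.exp (X2 * |(|ξ| - k₀)|) / Real.sqrt |(|ξ| - k₀)| ≤
        Real.exp (X2 * |ξ - k₀|) / Real.sqrt |ξ - k₀| +
          Real.exp (X2 * |ξ + k₀|) / Real.sqrt |ξ + k₀| := by
      rcases abs_cases ξ with ⟨h, -⟩ | ⟨h, -⟩
      · rw [h]
        exact le_add_of_nonneg_right (by positivity)
      · rw [h, show -ξ - k₀ = -(ξ + k₀) by ring, abs_neg]
        exact le_add_of_nonneg_left (by positivity)
    rw [norm_div]
    calc _ ≤ Real.exp (-2 * X2 * k₀) * Real.exp (X2 * |(|ξ| - k₀)|) /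
          (c * α * Real.sqrt k₀ * Real.sqrt |(|ξ| - k₀)|) := by gcongr
      _ = Real.exp (-2 * X2 * k₀) / (c * α * Real.sqrt k₀) *
          (Real.exp (X2 * |(|ξ| - k₀)|) / Real.sqrt |(|ξ| - k₀)|) := by
        rw [div_mul_div_comm]
      _ ≤ _ := mul_le_mul_of_nonneg_left hsum (by positivity)
end
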